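/- Let d ≥ 1, let ϖ ∈ (0,1), and let R ≥ 1. Then the cut-off function h_R satisfies the global Hölder estimate |h_R(x) − h_R(y)| ≤ 8 |x − y|^ϖ for all x, y ∈ ℝ^d. -/

import Mathlib

open MeasureTheory Set

/-- The radial cut-off function `h_R` as a function of the radius `r`. -/
noncomputable def cutoffH (R r : ℝ) : ℝ :=
  if r ≤ R then 0
  else if r ≤ 3 * R / 2 then (2 / R ^ 2) * (r - R) ^ 2
  else if r ≤ 2 * R then 1 - (2 / R ^ 2) * (r - 2 * R) ^ 2
  else 1

theorem cutoffH_eq_one_div {R : ℝ} (hR : 0 < R) (r : ℝ) :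
    cutoffH R r = cutoffH 1 (r / R) := by
  have h1 : r ≤ R ↔ r / R ≤ 1 := by rw [div_le_iff₀ hR, one_mul]
  have h2 : r ≤ 3 * R / 2 ↔ r / R ≤ 3 * 1 / 2 := by
    rw [div_le_iff₀ hR]; constructor <;> intro h <;> linarith
  have h3 : r ≤ 2 * R ↔ r / R ≤ 2 * 1 := by rw [div_le_iff₀ hR, mul_one]
  simp only [cutoffH, h1, h2, h3]
  split_ifs <;> first | rfl | (field_simp)

theorem cutoffH_mem_Icc {R : ℝ} (hR : 0 < R) (r : ℝ) : cutoffH R r ∈ Set.Icc (0 : ℝ) 1 := by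
  rw [cutoffH_eq_one_div hR]
  generalize r / R = t
  unfold cutoffH
  constructor <;> split_ifs <;> nlinarith

theorem abs_cutoffH_one_sub_le_of_le {r s : ℝ} (hrs : r ≤ s) :
    |cutoffH 1 r - cutoffH 1 s| ≤ 2 * (s - r) := by
  unfold cutoffH
  rw [abs_le]
  constructor <;> split_ifs <;> nlinarith

theorem abs_cutoffH_sub_le {R : ℝ} (hR : 0 < R) (r s : ℝ) :
    |cutoffH R r - cutoffH R s| ≤ 2 / R * |r - s| := by
  have key : 2 / R * |r - s| = 2 * |r / R - s / R| := by
    rw [← sub_div, abs_div, abs_of_pos hR]; ring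
  rw [key, cutoffH_eq_one_div hR r, cutoffH_eq_one_div hR s]
  rcases le_total (r / R) (s / R) with h | h
  · rw [abs_sub_comm (r / R), abs_of_nonneg (sub_nonneg.2 h)]
    exact abs_cutoffH_one_sub_le_of_le h
  · rw [abs_sub_comm, abs_of_nonneg (sub_nonneg.2 h)]
    exact abs_cutoffH_one_sub_le_of_le h

/-- For `d ≥ 1`, `ϖ ∈ (0,1)` and `R ≥ 1`, the cut-off function `h_R` satisfies the
global Hölder estimate `|h_R(x) − h_R(y)| ≤ 8 |x − y|^ϖ`. -/
theorem stmt_1 (d : ℕ) (hd : 1 ≤ d) (ϖ R : ℝ)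
    (hϖ : ϖ ∈ Set.Ioo (0 : ℝ) 1) (hR : 1 ≤ R)
    (h : EuclideanSpace ℝ (Fin d) → ℝ)
    (hdef : ∀ x, h x = cutoffH R ‖x‖) :
    ∀ x y : EuclideanSpace ℝ (Fin d), |h x - h y| ≤ 8 * ‖x - y‖ ^ ϖ := by
  intro x y
  have hR0 : 0 < R := by linarith
  rw [hdef, hdef]
  rcases le_total ‖x - y‖ 1 with hxy | hxy
  · have hpow : ‖x - y‖ ≤ ‖x - y‖ ^ ϖ := by
      simpa using Real.rpow_le_rpow_of_exponent_ge_of_imp (norm_nonneg (x - y)) hxy hϖ.2.le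
        (fun _ h0 => absurd h0 one_ne_zero)
    calc |cutoffH R ‖x‖ - cutoffH R ‖y‖| ≤ 2 / R * |‖x‖ - ‖y‖| := abs_cutoffH_sub_le hR0 _ _
      _ ≤ 2 * ‖x - y‖ :=
        mul_le_mul (div_le_self zero_le_two hR) (abs_norm_sub_norm_le x y) (abs_nonneg _)
          zero_le_two
      _ ≤ 8 * ‖x - y‖ ^ ϖ := by linarith [norm_nonneg (x - y)]
  · have hpow : 1 ≤ ‖x - y‖ ^ ϖ := Real.one_le_rpow hxy hϖ.1.le
    have hx := cutoffH_mem_Icc hR0 ‖x‖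
    have hy := cutoffH_mem_Icc hR0 ‖y‖
    rw [abs_le]
    constructor <;> linarith [hx.1, hx.2, hy.1, hy.2]
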